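/- Let k ≥ 1 be an integer and let H be the cycle C_{2k+1} or the cycle C_{2k+2}. If t = t(n) and b = b(n) satisfy t/(n·log n) → ∞ and b·t^{k+1}/n^{k+2} → 0 as n → ∞ (i.e. b ≪ n^{k+2}/t^{k+1}), then for every (t,b)-strategy B of Builder, the probability that the purchased graph B_t contains a subgraph isomorphic to H tends to 0 as n → ∞. -/

import Mathlib

open Filter

attribute [local instance] Classical.propDecidable

/-- The edges of the complete graph on `Fin n`: non-diagonal unordered pairs. -/
abbrev CEdge (n : ℕ) : Type := {e : Sym2 (Fin n) // ¬ e.IsDiag}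

/-- The sample space: a uniformly random ordering of the edges of `K_n`,
encoded as a bijection from positions to edges. -/
abbrev EdgeOrdering (n : ℕ) : Type := Fin (Fintype.card (CEdge n)) ≃ CEdge n

/-- The uniform probability of an event on a finite sample space. -/
noncomputable def uprob {α : Type} [Fintype α] (P : α → Prop) : ℝ :=
  ((Finset.univ.filter P).card : ℝ) / (Fintype.card α : ℝ)

/-- A (deterministic) strategy of Builder: given the current time `s`, the graph `B_{s-1}`
of previously purchased edges, and the observed edge `e_s`, decide whether to purchase it. -/
def Strategy (n : ℕ) : Type := ℕ → Finset (CEdge n) → CEdge n → Bool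

/-- Builder's purchased graph `B_s` at time `s`, playing strategy `S` with budget `b`
on the ordering `ω`.  An edge is purchased iff the strategy accepts it and the budget permits. -/
noncomputable def build (n b : ℕ) (S : Strategy n) (ω : EdgeOrdering n) : ℕ → Finset (CEdge n)
  | 0 => ∅
  | s + 1 =>
    let P := build n b S ω s
    if h : s < Fintype.card (CEdge n) then
      if S s P (ω ⟨s, h⟩) = true ∧ P.card < b then insert (ω ⟨s, h⟩) P else P
    else P

/-- The degree of the vertex `v` in the graph given by the edge set `P`. -/
noncomputable def edegree (n : ℕ) (P : Finset (CEdge n)) (v : Fin n) : ℕ :=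
  (P.filter (fun e => v ∈ (e : Sym2 (Fin n)))).card


/-- The edge set `P` contains a copy of the graph `H` (as a subgraph). -/
def containsCopy {k : ℕ} (H : SimpleGraph (Fin k)) (n : ℕ) (P : Finset (CEdge n)) : Prop :=
  ∃ f : Fin k → Fin n, Function.Injective f ∧
    ∀ u v : Fin k, H.Adj u v → ∃ e ∈ P, (e : Sym2 (Fin n)) = s(f u, f v)

section UniformProbability

variable {α : Type} [Fintype α]

lemma uprob_eq_sum (P : α → Prop) [DecidablePred P] :
    uprob P = (∑ ω, if P ω then (1 : ℝ) else 0) / (Fintype.card α : ℝ) := by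
  rw [uprob, Finset.sum_boole]
  congr!

lemma uprob_nonneg (P : α → Prop) : 0 ≤ uprob P := by
  unfold uprob; positivity

lemma uprob_le_one (P : α → Prop) : uprob P ≤ 1 := by
  unfold uprob
  exact div_le_one_of_le₀ (by exact_mod_cast Finset.card_le_univ _) (by positivity)

lemma uprob_mono {P Q : α → Prop} (h : ∀ ω, P ω → Q ω) : uprob P ≤ uprob Q := by
  unfold uprob
  gcongr
  exact h _

lemma uprob_or_le (P Q : α → Prop) : uprob (fun ω => P ω ∨ Q ω) ≤ uprob P + uprob Q := by
  unfold uprob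
  rw [← add_div]
  gcongr
  norm_cast
  refine le_trans (Finset.card_le_card ?_) (Finset.card_union_le _ _)
  intro ω
  simp

lemma uprob_exists_le {ι : Type*} (J : Finset ι) (P : ι → α → Prop) :
    uprob (fun ω => ∃ j ∈ J, P j ω) ≤ ∑ j ∈ J, uprob (P j) := by
  induction J using Finset.induction_on with
  | empty => simp [uprob]
  | insert a J ha ih =>
    rw [Finset.sum_insert ha]
    refine le_trans (uprob_mono (Q := fun ω => P a ω ∨ ∃ j ∈ J, P j ω) ?_)
      ((uprob_or_le _ _).trans (by gcongr))
    intro ω h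
    simpa using h

lemma uprob_comp_equiv (σ : α ≃ α) (P : α → Prop) : uprob (fun ω => P (σ ω)) = uprob P := by
  rw [uprob_eq_sum, uprob_eq_sum, Equiv.sum_comp σ (fun ω => if P ω then (1 : ℝ) else 0)]

lemma sum_uprob {ι : Type*} (J : Finset ι) (P : ι → α → Prop)
    [∀ ω, DecidablePred fun j => P j ω] :
    ∑ j ∈ J, uprob (P j) =
      (∑ ω, ((J.filter (fun j => P j ω)).card : ℝ)) / (Fintype.card α : ℝ) := by
  simp_rw [uprob_eq_sum, ← Finset.sum_div]
  rw [Finset.sum_comm]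
  congr! 2 with ω
  rw [Finset.sum_boole]

lemma sum_uprob_le {ι : Type*} (J : Finset ι) (P : ι → α → Prop)
    [∀ ω, DecidablePred fun j => P j ω] (M : ℕ)
    (h : ∀ ω, (J.filter (fun j => P j ω)).card ≤ M) : ∑ j ∈ J, uprob (P j) ≤ M := by
  rw [sum_uprob]
  refine div_le_of_le_mul₀ (by positivity) (by positivity) ?_
  calc (∑ ω, ((J.filter (fun j => P j ω)).card : ℝ)) ≤ ∑ _ω : α, (M : ℝ) := by
        gcongr with ω; exact_mod_cast h ω
    _ = M * Fintype.card α := by simp [mul_comm]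

end UniformProbability

section RandomProcess

variable {n : ℕ}

/-- The edge revealed at time `s` rarely falls in a small set determined by the past. -/
lemma uprob_apply_mem_le {s : ℕ} (hs : s < Fintype.card (CEdge n)) (M : ℕ)
    (X : EdgeOrdering n → Finset (CEdge n))
    (hX : ∀ ω ω' : EdgeOrdering n, (∀ i : Fin _, (i : ℕ) < s → ω i = ω' i) → X ω = X ω')
    (hM : ∀ ω, (X ω).card ≤ M) :
    uprob (fun ω : EdgeOrdering n => ω ⟨s, hs⟩ ∈ X ω) ≤
      M / ((Fintype.card (CEdge n) : ℝ) - s) := by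
  have hpos : (0 : ℝ) < (Fintype.card (CEdge n) : ℝ) - s := by
    rw [sub_pos]; exact_mod_cast hs
  rw [le_div_iff₀ hpos]
  have key : ∀ j ∈ Finset.Ici (⟨s, hs⟩ : Fin (Fintype.card (CEdge n))),
      uprob (fun ω : EdgeOrdering n => ω j ∈ X ω) =
        uprob (fun ω : EdgeOrdering n => ω ⟨s, hs⟩ ∈ X ω) := by
    intro j hj
    rw [← uprob_comp_equiv (Equiv.equivCongr (Equiv.swap ⟨s, hs⟩ j) (Equiv.refl _))]
    congr 1
    funext ω
    have h1 : X (Equiv.equivCongr (Equiv.swap ⟨s, hs⟩ j) (Equiv.refl _) ω) = X ω := by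
      apply hX
      intro i hi
      have hsj : s ≤ (j : ℕ) := by simpa [Fin.le_def] using hj
      have : Equiv.swap (⟨s, hs⟩ : Fin (Fintype.card (CEdge n))) j i = i := by
        refine Equiv.swap_apply_of_ne_of_ne (fun h => ?_) (fun h => ?_) <;> rw [h] at hi
        · exact absurd hi (lt_irrefl _)
        · omega
      simp [Equiv.equivCongr, this]
    rw [h1]
    simp [Equiv.equivCongr]
  have h2 := sum_uprob_le (Finset.Ici (⟨s, hs⟩ : Fin (Fintype.card (CEdge n))))
    (fun j (ω : EdgeOrdering n) => ω j ∈ X ω) M (by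
      intro ω
      refine le_trans (Finset.card_le_card_of_injOn (fun j => ω j) ?_ ω.injective.injOn) (hM ω)
      intro j hj
      exact ((@Finset.mem_filter _ _ _ _ _).1 (Finset.mem_coe.1 hj)).2)
  rw [Finset.sum_congr rfl key, Finset.sum_const, Fin.card_Ici, nsmul_eq_mul,
    Nat.cast_sub hs.le] at h2
  linarith

/-- The edge set of the graph `G_t` of the random graph process. -/
noncomputable def processEdges (t : ℕ) (ω : EdgeOrdering n) : Finset (CEdge n) :=
  Finset.univ.filter (fun e => (ω.symm e : ℕ) < t)

@[simp]
lemma mem_processEdges {t : ℕ} {ω : EdgeOrdering n} {e : CEdge n} :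
    e ∈ processEdges t ω ↔ (ω.symm e : ℕ) < t := by
  simp [processEdges]

lemma card_processEdges {t : ℕ} (ht : t ≤ Fintype.card (CEdge n)) (ω : EdgeOrdering n) :
    (processEdges t ω).card = t := by
  have : processEdges t ω =
      (Finset.univ.filter (fun i : Fin (Fintype.card (CEdge n)) => (i : ℕ) < t)).map
        ω.toEmbedding := by
    ext e
    simp [Finset.mem_map_equiv]
  rw [this, Finset.card_map, Fin.card_filter_val_lt]
  omega

/-- A fixed set of edges is contained in `G_t` with probability at most `(t / N) ^ |F|`. -/
lemma uprob_subset_processEdges_le {t : ℕ} (ht : t ≤ Fintype.card (CEdge n))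
    (F : Finset (CEdge n)) :
    uprob (fun ω : EdgeOrdering n => F ⊆ processEdges t ω) ≤
      ((t : ℝ) / Fintype.card (CEdge n)) ^ F.card := by
  induction F using Finset.induction_on with
  | empty => simpa using uprob_le_one _
  | insert e F he ih =>
    have key : ∀ e' ∈ Fᶜ, uprob (fun ω : EdgeOrdering n => insert e' F ⊆ processEdges t ω) =
        uprob (fun ω : EdgeOrdering n => insert e F ⊆ processEdges t ω) := by
      intro e' he'
      rw [Finset.mem_compl] at he'
      rw [← uprob_comp_equiv (Equiv.equivCongr (Equiv.refl _) (Equiv.swap e e'))]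
      congr 1
      funext ω
      have hF : ∀ f ∈ F, Equiv.swap e e' f = f := fun f hf =>
        Equiv.swap_apply_of_ne_of_ne (by rintro rfl; exact he hf) (by rintro rfl; exact he' hf)
      simp only [Finset.insert_subset_iff, Finset.subset_iff (s₁ := F), mem_processEdges,
        Equiv.equivCongr, Equiv.coe_fn_mk,
        Equiv.symm_trans_apply, Equiv.refl_symm, Equiv.coe_refl, id, Equiv.symm_swap, eq_iff_iff]
      refine and_congr ?_ (forall₂_congr fun f hf => ?_)
      · simp
      · simp [hF f hf]
    have h1 := sum_uprob Fᶜ (fun e' (ω : EdgeOrdering n) => insert e' F ⊆ processEdges t ω)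
    rw [Finset.sum_congr rfl key, Finset.sum_const, Finset.card_compl, nsmul_eq_mul] at h1
    have h2 : ∀ ω : EdgeOrdering n,
        ((Fᶜ.filter (fun e' => insert e' F ⊆ processEdges t ω)).card : ℝ) =
          ((t : ℝ) - F.card) * (if F ⊆ processEdges t ω then (1 : ℝ) else 0) := by
      intro ω
      split_ifs with hF
      · have : Fᶜ.filter (fun e' => insert e' F ⊆ processEdges t ω) = processEdges t ω \ F := by
          ext x
          simp [Finset.insert_subset_iff, hF, and_comm]
        rw [this, Finset.card_sdiff_of_subset hF, Nat.cast_sub (Finset.card_le_card hF),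
          card_processEdges ht, mul_one]
      · rw [mul_zero, Nat.cast_eq_zero, Finset.card_eq_zero, Finset.filter_eq_empty_iff]
        exact fun x _ h => hF ((Finset.subset_insert _ _).trans h)
    simp_rw [h2] at h1
    rw [← Finset.mul_sum, mul_div_assoc, ← uprob_eq_sum] at h1
    have hFN : F.card < Fintype.card (CEdge n) := by
      rw [← Finset.card_univ]
      exact Finset.card_lt_card
        ((Finset.ssubset_univ_iff).2 (fun h => he (h ▸ Finset.mem_univ e)))
    rw [Nat.cast_sub hFN.le] at h1
    rw [Finset.card_insert_of_notMem he, pow_succ']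
    set x := uprob (fun ω : EdgeOrdering n => insert e F ⊆ processEdges t ω)
    set y := uprob (fun ω : EdgeOrdering n => F ⊆ processEdges t ω)
    have hy : 0 ≤ y := uprob_nonneg _
    have hN : (F.card : ℝ) < Fintype.card (CEdge n) := by exact_mod_cast hFN
    have hN0 : (0 : ℝ) < Fintype.card (CEdge n) := lt_of_le_of_lt (by positivity) hN
    have htN : (t : ℝ) ≤ Fintype.card (CEdge n) := by exact_mod_cast ht
    have h3 : x ≤ (t : ℝ) / Fintype.card (CEdge n) * y := by
      rw [div_mul_eq_mul_div, le_div_iff₀ hN0]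
      have h4 : ((Fintype.card (CEdge n) : ℝ) - F.card) * (x * Fintype.card (CEdge n)) ≤
          ((Fintype.card (CEdge n) : ℝ) - F.card) * (t * y) := by
        have h5 : 0 ≤ (F.card : ℝ) * y * (Fintype.card (CEdge n) - t) :=
          mul_nonneg (by positivity) (by linarith)
        have h6 : ((Fintype.card (CEdge n) : ℝ) - F.card) * (x * Fintype.card (CEdge n)) =
            ((t : ℝ) - F.card) * y * Fintype.card (CEdge n) := by rw [← h1]; ring
        rw [h6]; linarith
      exact le_of_mul_le_mul_left h4 (by linarith)
    exact h3.trans (by gcongr)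

lemma build_congr (b : ℕ) (S : Strategy n) {s : ℕ} {ω ω' : EdgeOrdering n}
    (h : ∀ i : Fin _, (i : ℕ) < s → ω i = ω' i) : build n b S ω s = build n b S ω' s := by
  induction s with
  | zero => rfl
  | succ s ih =>
    have ih' := ih (fun i hi => h i (hi.trans (Nat.lt_succ_self s)))
    simp only [build, ih']
    by_cases hs : s < Fintype.card (CEdge n)
    · rw [dif_pos hs, dif_pos hs, h ⟨s, hs⟩ (Nat.lt_succ_self s)]
    · rw [dif_neg hs, dif_neg hs]

lemma build_subset_processEdges (b : ℕ) (S : Strategy n) (ω : EdgeOrdering n) (s : ℕ) :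
    build n b S ω s ⊆ processEdges s ω := by
  induction s with
  | zero => simp [build]
  | succ s ih =>
    have ih' : build n b S ω s ⊆ processEdges (s + 1) ω := fun e he => by
      have := ih he
      simp only [mem_processEdges] at this ⊢
      omega
    simp only [build]
    split_ifs
    · exact Finset.insert_subset (by simp) ih'
    · exact ih'
    · exact ih'

lemma card_build_le (b : ℕ) (S : Strategy n) (ω : EdgeOrdering n) (s : ℕ) :
    (build n b S ω s).card ≤ b := by
  induction s with
  | zero => simp [build]
  | succ s ih =>
    simp only [build]
    split_ifs with h1 h2
    · exact (Finset.card_insert_le _ _).trans h2.2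
    · exact ih
    · exact ih

lemma processEdges_mono {s t : ℕ} (h : s ≤ t) (ω : EdgeOrdering n) :
    processEdges s ω ⊆ processEdges t ω := by
  intro e he
  simp only [mem_processEdges] at he ⊢
  omega

end RandomProcess

section SparseGraphs

variable {V : Type*}

lemma card_filter_mem_sym2_le_two (U : Finset V) (e : Sym2 V) :
    (U.filter (fun v => v ∈ e)).card ≤ 2 := by
  refine le_trans (Finset.card_le_card (t := e.toFinset) ?_) ?_
  · intro v hv
    simpa using (Finset.mem_filter.1 hv).2
  · rw [Sym2.card_toFinset]
    split_ifs <;> omega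

/-- A hereditarily sparse graph has an orientation with bounded out-degrees. -/
lemma exists_orientation (E : Finset (Sym2 V)) (U : Finset V)
    (h : ∀ U' ⊆ U, U'.Nonempty → (E.filter (fun e => ∀ x ∈ e, x ∈ U')).card < 3 * U'.card) :
    ∃ out : V → Finset V, (∀ v, (out v).card ≤ 6) ∧
      ∀ u ∈ U, ∀ v ∈ U, s(u, v) ∈ E → v ∈ out u ∨ u ∈ out v := by
  induction hm : U.card generalizing U with
  | zero =>
    rw [Finset.card_eq_zero] at hm
    subst hm
    exact ⟨fun _ => ∅, by simp, by simp⟩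
  | succ m ih =>
    have hne : U.Nonempty := Finset.card_pos.1 (by omega)
    set F := E.filter (fun e => ∀ x ∈ e, x ∈ U) with hF
    have hdeg : ∃ w ∈ U, (F.filter (fun e => w ∈ e)).card < 6 := by
      by_contra! hcon
      have h1 : U.card * 6 ≤ F.card * 2 :=
        Finset.card_mul_le_card_mul (fun v e => v ∈ e)
          (fun v hv => by simpa [Finset.bipartiteAbove] using hcon v hv)
          (fun e _ => card_filter_mem_sym2_le_two U e)
      have h2 : F.card < 3 * U.card := h U subset_rfl hne
      omega
    obtain ⟨w, hw, hwdeg⟩ := hdeg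
    obtain ⟨out, hout, hor⟩ := ih (U.erase w)
      (fun U' hU' => h U' (hU'.trans (Finset.erase_subset _ _)))
      (by rw [Finset.card_erase_of_mem hw]; omega)
    refine ⟨fun v => if v = w then U.filter (fun x => s(w, x) ∈ E) else out v, ?_, ?_⟩
    · intro v
      dsimp only
      split_ifs
      · refine le_trans (Finset.card_le_card_of_injOn (fun x => s(w, x))
          (t := F.filter (fun e => w ∈ e)) ?_ ?_) hwdeg.le
        · intro x hx
          simp only [Finset.coe_filter, Set.mem_ofPred_eq] at hx
          simp [hF, hx.1, hx.2, hw]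
        · intro x _ y _ hxy
          exact Sym2.congr_right.1 hxy
      · exact hout v
    · intro u hu v hv huv
      by_cases hu' : u = w
      · left
        subst hu'
        simp [hv, huv]
      · by_cases hv' : v = w
        · right
          subst hv'
          rw [Sym2.eq_swap] at huv
          simp [hu, huv]
        · simpa [hu', hv'] using hor u (Finset.mem_erase.2 ⟨hu', hu⟩) v
            (Finset.mem_erase.2 ⟨hv', hv⟩) huv

/-- The vertices reached from `u` by `L` steps, of which at most `j` go along `nb` and the others
along `out`. -/
noncomputable def reach (out nb : V → Finset V) : ℕ → ℕ → V → Finset V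
  | 0, _, u => {u}
  | L + 1, 0, u => (out u).biUnion (reach out nb L 0)
  | L + 1, j + 1, u => (out u).biUnion (reach out nb L (j + 1)) ∪ (nb u).biUnion (reach out nb L j)

lemma card_reach_le (out nb : V → Finset V) {D : ℕ} (hout : ∀ v, (out v).card ≤ 6)
    (hnb : ∀ v, (nb v).card ≤ D) (hD : 1 ≤ D) (L j : ℕ) (u : V) :
    (reach out nb L j u).card ≤ 7 ^ L * D ^ j := by
  have step : ∀ (N : V → Finset V) (c : ℕ), (∀ v, (N v).card ≤ c) → ∀ (A : V → Finset V) (M : ℕ),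
      (∀ v, (A v).card ≤ M) → ∀ v, ((N v).biUnion A).card ≤ c * M := fun N c hN A M hA v =>
    (Finset.card_biUnion_le_card_mul _ _ _ fun w _ => hA w).trans
      (Nat.mul_le_mul_right _ (hN v))
  induction L generalizing j u with
  | zero => simpa [reach] using Nat.one_le_pow j D hD
  | succ L ih =>
    cases j with
    | zero =>
      refine (step out 6 hout _ _ (ih 0) u).trans ?_
      rw [pow_succ, pow_zero]
      omega
    | succ j =>
      refine (Finset.card_union_le _ _).trans (le_trans (add_le_add
        (step out 6 hout _ _ (ih (j + 1)) u) (step nb D hnb _ _ (ih j) u)) ?_)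
      apply le_of_eq
      ring

lemma mem_reach (out nb : V → Finset V) (L j : ℕ) (g : ℕ → V)
    (hg : ∀ i < L, g (i + 1) ∈ nb (g i))
    (hj : ∑ i ∈ Finset.range L, (if g (i + 1) ∈ out (g i) then 0 else 1) ≤ j) :
    g L ∈ reach out nb L j (g 0) := by
  induction L generalizing j g with
  | zero => simp [reach]
  | succ L ih =>
    rw [Finset.sum_range_succ'] at hj
    have ih' := fun j' => ih j' (fun i => g (i + 1)) (fun i hi => hg (i + 1) (by omega))
    by_cases h0 : g (0 + 1) ∈ out (g 0)
    · rw [if_pos h0, add_zero] at hj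
      have hmem : g (L + 1) ∈ (out (g 0)).biUnion (reach out nb L j) :=
        Finset.mem_biUnion.2 ⟨_, h0, ih' j hj⟩
      cases j with
      | zero => exact hmem
      | succ j => exact Finset.mem_union_left _ hmem
    · rw [if_neg h0] at hj
      cases j with
      | zero => omega
      | succ j =>
        exact Finset.mem_union_right _
          (Finset.mem_biUnion.2 ⟨_, hg 0 (by omega), ih' j (by omega)⟩)

/-- One of the two directions of a walk uses few steps against the orientation. -/
lemma mem_reach_or_mem_reach (out nb : V → Finset V) {L k : ℕ} (hL : L ≤ 2 * k + 1) (g : ℕ → V)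
    (hg : ∀ i < L, g (i + 1) ∈ nb (g i)) (hg' : ∀ i < L, g i ∈ nb (g (i + 1)))
    (hor : ∀ i < L, g (i + 1) ∈ out (g i) ∨ g i ∈ out (g (i + 1))) :
    g L ∈ reach out nb L k (g 0) ∨ g 0 ∈ reach out nb L k (g L) := by
  have hsum : (∑ i ∈ Finset.range L, if g (i + 1) ∈ out (g i) then 0 else 1) +
      (∑ i ∈ Finset.range L, if g i ∈ out (g (i + 1)) then 0 else 1) ≤ L := by
    rw [← Finset.sum_add_distrib]
    refine (Finset.sum_le_card_nsmul _ _ 1 fun i hi => ?_).trans (by simp)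
    rcases hor i (Finset.mem_range.1 hi) with h | h <;> rw [if_pos h] <;> split_ifs <;> omega
  by_cases hk : (∑ i ∈ Finset.range L, if g (i + 1) ∈ out (g i) then 0 else 1) ≤ k
  · exact Or.inl (mem_reach out nb L k g hg hk)
  · right
    have := mem_reach out nb L k (fun i => g (L - i)) (fun i hi => by
      have := hg' (L - (i + 1)) (by omega)
      rwa [show L - (i + 1) + 1 = L - i by omega] at this) (by
      rw [← Finset.sum_range_reflect] at hsum
      rw [← Finset.sum_range_reflect (fun i => if g i ∈ out (g (i + 1)) then 0 else 1)] at hsum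
      have hc : (∑ i ∈ Finset.range L, if g (L - (i + 1)) ∈ out (g (L - i)) then 0 else 1) =
          ∑ i ∈ Finset.range L, if g (L - 1 - i) ∈ out (g (L - 1 - i + 1)) then 0 else 1 := by
        refine Finset.sum_congr rfl fun i hi => ?_
        have := Finset.mem_range.1 hi
        rw [show L - 1 - i + 1 = L - i by omega, show L - (i + 1) = L - 1 - i by omega]
      rw [hc]
      rw [← Finset.sum_range_reflect] at hk
      omega)
    simpa using this

end SparseGraphs

section ClosingEdges

variable {n : ℕ}

/-- The edges joining the two ends of a walk of length `L` in the graph with edge set `P`. -/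
noncomputable def closingEdges (P : Finset (CEdge n)) (L : ℕ) : Finset (CEdge n) :=
  Finset.univ.filter (fun e => ∃ g : ℕ → Fin n,
    (∀ i < L, ∃ e' ∈ P, (e' : Sym2 (Fin n)) = s(g i, g (i + 1))) ∧
      (e : Sym2 (Fin n)) = s(g 0, g L))

lemma card_closingEdges_le (P : Finset (CEdge n)) {b D k L : ℕ} (hP : P.card ≤ b)
    (hD : 1 ≤ D)
    (hdeg : ∀ v, (P.filter (fun e : CEdge n => v ∈ (e : Sym2 (Fin n)))).card ≤ D)
    (hsparse : ∀ U : Finset (Fin n), U.Nonempty → U.card ≤ 2 * b →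
      (P.filter (fun e : CEdge n => ∀ x ∈ (e : Sym2 (Fin n)), x ∈ U)).card < 3 * U.card)
    (hL0 : 0 < L) (hL : L ≤ 2 * k + 1) :
    (closingEdges P L).card ≤ 2 * b * (7 ^ L * D ^ k) := by
  set W := P.biUnion (fun e => (e : Sym2 (Fin n)).toFinset) with hW
  have hWcard : W.card ≤ 2 * b := by
    refine (Finset.card_biUnion_le_card_mul _ _ 2 fun e _ => ?_).trans (by omega)
    rw [Sym2.card_toFinset]
    split_ifs <;> omega
  set E := P.map ⟨Subtype.val, Subtype.val_injective⟩ with hE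
  obtain ⟨out, hout, hor⟩ := exists_orientation E W (fun U' hU' hne => by
    have := hsparse U' hne ((Finset.card_le_card hU').trans hWcard)
    refine lt_of_le_of_lt (Finset.card_le_card_of_surjOn Subtype.val ?_) this
    intro e he
    simp only [hE, Finset.coe_filter, Finset.mem_map, Set.mem_ofPred_eq] at he
    obtain ⟨⟨e, he, rfl⟩, h⟩ := he
    exact ⟨e, by simpa using ⟨he, h⟩, rfl⟩)
  have hmemE : ∀ u v, (∃ e ∈ P, (e : Sym2 (Fin n)) = s(u, v)) → s(u, v) ∈ E := by
    rintro u v ⟨e, he, h⟩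
    rw [hE, Finset.mem_map]
    exact ⟨e, he, h⟩
  have hmemW : ∀ u v, (∃ e ∈ P, (e : Sym2 (Fin n)) = s(u, v)) → u ∈ W := by
    rintro u v ⟨e, he, h⟩
    rw [hW, Finset.mem_biUnion]
    exact ⟨e, he, by simp [h]⟩
  set nb : Fin n → Finset (Fin n) := fun v => Finset.univ.filter (fun x => s(v, x) ∈ E) with hnb
  have hnbcard : ∀ v, (nb v).card ≤ D := by
    intro v
    refine le_trans ?_ (hdeg v)
    rw [← Finset.card_map ⟨Subtype.val, Subtype.val_injective⟩]
    refine Finset.card_le_card_of_injOn (fun x => s(v, x)) ?_ ?_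
    · intro x hx
      simp only [hnb, Finset.coe_filter, Set.mem_ofPred_eq, hE, Finset.mem_map] at hx
      obtain ⟨_, e, he, h⟩ := hx
      rw [Finset.mem_coe, Finset.mem_map]
      refine ⟨e, ?_, h⟩
      simp only [Finset.mem_filter]
      exact ⟨he, by rw [show (e : Sym2 (Fin n)) = s(v, x) from h]; simp⟩
    · intro x _ y _ hxy
      exact Sym2.congr_right.1 hxy
  have hsub : (closingEdges P L).map ⟨Subtype.val, Subtype.val_injective⟩ ⊆
      W.biUnion (fun u => (reach out nb L k u).image (fun v => s(u, v))) := by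
    intro e he
    rw [Finset.mem_map] at he
    obtain ⟨e, he, rfl⟩ := he
    simp only [closingEdges, Finset.mem_filter, Finset.mem_univ, true_and] at he
    obtain ⟨g, hg, he⟩ := he
    have hsw : ∀ i < L, ∃ e' ∈ P, (e' : Sym2 (Fin n)) = s(g (i + 1), g i) := fun i hi => by
      rw [Sym2.eq_swap]; exact hg i hi
    have hL1 := hsw (L - 1) (by omega)
    rw [Nat.sub_add_cancel hL0] at hL1
    simp only [Function.Embedding.coeFn_mk, he, Finset.mem_biUnion, Finset.mem_image]
    rcases mem_reach_or_mem_reach out nb hL g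
      (fun i hi => by simpa [hnb] using hmemE _ _ (hg i hi))
      (fun i hi => by simpa [hnb] using hmemE _ _ (hsw i hi))
      (fun i hi => hor _ (hmemW _ _ (hg i hi)) _ (hmemW _ _ (hsw i hi)) (hmemE _ _ (hg i hi)))
      with h | h
    · exact ⟨g 0, hmemW _ _ (hg 0 hL0), g L, h, rfl⟩
    · exact ⟨g L, hmemW _ _ hL1, g 0, h, Sym2.eq_swap⟩
  rw [← Finset.card_map ⟨Subtype.val, Subtype.val_injective⟩]
  refine (Finset.card_le_card hsub).trans ((Finset.card_biUnion_le_card_mul _ _ _ fun u _ =>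
    Finset.card_image_le.trans (card_reach_le out nb hout hnbcard hD L k u)).trans ?_)
  gcongr

open Fin.CommRing in
/-- An edge completing a cycle of length `L + 1` joins the ends of a walk of length `L`. -/
lemma exists_walk_of_containsCopy_insert {L : ℕ} (hL : 2 ≤ L) (P : Finset (CEdge n)) (e : CEdge n)
    (h : containsCopy (SimpleGraph.cycleGraph (L + 1)) n (insert e P))
    (hP : ¬ containsCopy (SimpleGraph.cycleGraph (L + 1)) n P) : e ∈ closingEdges P L := by
  obtain ⟨m, rfl⟩ : ∃ m, L = m + 1 := ⟨L - 1, by omega⟩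
  obtain ⟨f, hf, hadj⟩ := h
  have hstep : ∀ i : Fin (m + 1 + 1), ∃ e' ∈ insert e P, (e' : Sym2 (Fin n)) = s(f i, f (i + 1)) :=
    fun i => hadj i (i + 1) (by simp [SimpleGraph.cycleGraph_adj])
  obtain ⟨c, hc⟩ : ∃ c : Fin (m + 1 + 1), (e : Sym2 (Fin n)) = s(f c, f (c + 1)) := by
    by_contra! hcon
    refine hP ⟨f, hf, ?_⟩
    have hstep' : ∀ i : Fin (m + 1 + 1), ∃ e' ∈ P, (e' : Sym2 (Fin n)) = s(f i, f (i + 1)) := by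
      intro i
      obtain ⟨e', he', h⟩ := hstep i
      rcases Finset.mem_insert.1 he' with rfl | he'
      · exact absurd h (hcon i)
      · exact ⟨e', he', h⟩
    intro u v huv
    rw [SimpleGraph.cycleGraph_adj] at huv
    rcases huv with huv | huv
    · rw [sub_eq_iff_eq_add'.1 huv, Sym2.eq_swap]
      exact hstep' v
    · rw [sub_eq_iff_eq_add'.1 huv]
      exact hstep' u
  have huniq : ∀ i : Fin (m + 1 + 1), (e : Sym2 (Fin n)) = s(f i, f (i + 1)) → i = c := by
    intro i hi
    rw [hc, Sym2.eq_iff] at hi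
    rcases hi with ⟨h1, _⟩ | ⟨h1, h2⟩
    · exact (hf h1).symm
    · have h1 := hf h1
      have h2 := hf h2
      rw [← h2, add_assoc c, left_eq_add] at h1
      have h3 := congrArg Fin.val h1
      rw [Fin.val_add, Fin.val_one, Nat.mod_eq_of_lt (by omega)] at h3
      simp at h3
  simp only [closingEdges, Finset.mem_filter, Finset.mem_univ, true_and]
  refine ⟨fun i => f (c + 1 + (i : Fin (m + 1 + 1))), ?_, ?_⟩
  · intro i hi
    obtain ⟨e', he', h⟩ := hstep (c + 1 + (i : Fin (m + 1 + 1)))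
    refine ⟨e', ?_, ?_⟩
    · rcases Finset.mem_insert.1 he' with rfl | he'
      · have h1 := huniq _ h
        rw [add_assoc c, add_eq_left] at h1
        have h2 : ((1 + i : ℕ) : Fin (m + 1 + 1)) = 0 := by push_cast; exact h1
        rw [Fin.natCast_eq_zero] at h2
        exact absurd (Nat.le_of_dvd (by omega) h2) (by omega)
      · exact he'
    · rw [h]
      push_cast
      simp only [add_assoc]
  · have h1 : c + 1 + ((m + 1 : ℕ) : Fin (m + 1 + 1)) = c := by
      rw [add_assoc c, add_eq_left]
      have h2 : ((1 + (m + 1) : ℕ) : Fin (m + 1 + 1)) = 0 :=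
        Fin.natCast_eq_zero.2 ⟨1, by ring⟩
      push_cast at h2 ⊢
      exact h2
    rw [hc, Sym2.eq_swap]
    simp only [h1, Nat.cast_zero, add_zero]

end ClosingEdges

section UnionBounds

lemma inv_factorial_le {r : ℕ} (hr : 0 < r) : (1 : ℝ) / (r.factorial : ℝ) ≤ (3 / (r : ℝ)) ^ r := by
  have h1 := Real.pow_div_factorial_le_exp (r : ℝ) (by positivity) r
  have h2 : Real.exp (r : ℝ) ≤ 3 ^ r := by
    rw [← mul_one (r : ℝ), Real.exp_nat_mul]
    gcongr
    exact Real.exp_one_lt_three.le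
  have hr' : (0 : ℝ) < (r : ℝ) ^ r := by positivity
  rw [div_pow, le_div_iff₀ hr', one_div_mul_eq_div]
  exact h1.trans h2

lemma choose_le_div_pow (a : ℕ) {r : ℕ} (hr : 0 < r) : (a.choose r : ℝ) ≤ (3 * a / r) ^ r := by
  calc (a.choose r : ℝ) ≤ (a : ℝ) ^ r / (r.factorial : ℝ) := Nat.choose_le_pow_div r a
    _ = (a : ℝ) ^ r * (1 / (r.factorial : ℝ)) := by ring
    _ ≤ (a : ℝ) ^ r * (3 / (r : ℝ)) ^ r := by gcongr; exact inv_factorial_le hr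
    _ = _ := by rw [← mul_pow]; congr 1; ring

variable {n : ℕ}

/-- Tail bound for the number of edges of a given set appearing in `G_t`. -/
lemma uprob_le_card_filter_le {t : ℕ} (ht : t ≤ Fintype.card (CEdge n)) (A : Finset (CEdge n))
    {a r : ℕ} (hA : A.card ≤ a) (hr : 0 < r) :
    uprob (fun ω : EdgeOrdering n => r ≤ (A ∩ processEdges t ω).card) ≤
      (3 * a / r * ((t : ℝ) / Fintype.card (CEdge n))) ^ r := by
  calc uprob (fun ω : EdgeOrdering n => r ≤ (A ∩ processEdges t ω).card)
      ≤ uprob (fun ω : EdgeOrdering n => ∃ F ∈ A.powersetCard r, F ⊆ processEdges t ω) := by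
        refine uprob_mono fun ω h => ?_
        obtain ⟨F, hF, hFr⟩ := Finset.exists_subset_card_eq h
        exact ⟨F, Finset.mem_powersetCard.2 ⟨hF.trans Finset.inter_subset_left, hFr⟩,
          hF.trans Finset.inter_subset_right⟩
    _ ≤ ∑ F ∈ A.powersetCard r, uprob (fun ω : EdgeOrdering n => F ⊆ processEdges t ω) :=
        uprob_exists_le _ _
    _ ≤ ∑ F ∈ A.powersetCard r, ((t : ℝ) / Fintype.card (CEdge n)) ^ r := by
        refine Finset.sum_le_sum fun F hF => ?_
        rw [← (Finset.mem_powersetCard.1 hF).2]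
        exact uprob_subset_processEdges_le ht F
    _ = (A.card.choose r : ℝ) * ((t : ℝ) / Fintype.card (CEdge n)) ^ r := by
        rw [Finset.sum_const, Finset.card_powersetCard, nsmul_eq_mul]
    _ ≤ (3 * a / r) ^ r * ((t : ℝ) / Fintype.card (CEdge n)) ^ r := by
        gcongr
        exact le_trans (by exact_mod_cast Nat.choose_le_choose r hA) (choose_le_div_pow a hr)
    _ = _ := (mul_pow _ _ _).symm

/-- The edges of `K_n` at the vertex `v`. -/
noncomputable def starEdges (v : Fin n) : Finset (CEdge n) :=
  Finset.univ.filter (fun e : CEdge n => v ∈ (e : Sym2 (Fin n)))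

/-- The edges of `K_n` inside the vertex set `U`. -/
noncomputable def insideEdges (U : Finset (Fin n)) : Finset (CEdge n) :=
  Finset.univ.filter (fun e : CEdge n => ∀ x ∈ (e : Sym2 (Fin n)), x ∈ U)

lemma card_starEdges_le (v : Fin n) : (starEdges v).card ≤ n := by
  rw [← Finset.card_map ⟨Subtype.val, Subtype.val_injective⟩]
  refine (Finset.card_le_card (t := Finset.univ.image (fun x => s(v, x))) ?_).trans
    (Finset.card_image_le.trans (by simp))
  intro e he
  rw [Finset.mem_map] at he
  obtain ⟨e, he, rfl⟩ := he
  obtain ⟨x, hx⟩ := ((@Finset.mem_filter _ _ _ _ _).1 he).2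
  exact Finset.mem_image.2 ⟨x, Finset.mem_univ _, hx.symm⟩

lemma card_insideEdges_le (U : Finset (Fin n)) : (insideEdges U).card ≤ U.card ^ 2 := by
  rw [← Finset.card_map ⟨Subtype.val, Subtype.val_injective⟩]
  refine (Finset.card_le_card (t := (U ×ˢ U).image (fun x => s(x.1, x.2))) ?_).trans
    (Finset.card_image_le.trans (by rw [Finset.card_product, sq]))
  intro e he
  rw [Finset.mem_map] at he
  obtain ⟨e, he, rfl⟩ := he
  have h := ((@Finset.mem_filter _ _ _ _ _).1 he).2
  obtain ⟨e, _⟩ := e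
  induction e with
  | _ x y =>
    exact Finset.mem_image.2 ⟨(x, y), Finset.mem_product.2 ⟨h x (by simp), h y (by simp)⟩, rfl⟩

lemma uprob_exists_degree_le {t D : ℕ} (ht : t ≤ Fintype.card (CEdge n)) (hD : 0 < D) :
    uprob (fun ω : EdgeOrdering n => ∃ v, D ≤ (starEdges v ∩ processEdges t ω).card) ≤
      n * (3 * n / D * ((t : ℝ) / Fintype.card (CEdge n))) ^ D := by
  calc _ ≤ uprob (fun ω : EdgeOrdering n => ∃ v ∈ (Finset.univ : Finset (Fin n)),
            D ≤ (starEdges v ∩ processEdges t ω).card) := uprob_mono fun ω ⟨v, h⟩ => ⟨v, by simp, h⟩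
    _ ≤ ∑ v : Fin n, uprob (fun ω : EdgeOrdering n =>
          D ≤ (starEdges v ∩ processEdges t ω).card) := uprob_exists_le _ _
    _ ≤ ∑ _v : Fin n, (3 * n / D * ((t : ℝ) / Fintype.card (CEdge n))) ^ D :=
        Finset.sum_le_sum fun v _ => uprob_le_card_filter_le ht _ (card_starEdges_le v) hD
    _ = _ := by simp

lemma sum_pow_succ_le {q : ℝ} (hq0 : 0 ≤ q) (hq : q ≤ 1 / 2) (m : ℕ) :
    ∑ i ∈ Finset.range m, q ^ (i + 1) ≤ 2 * q := by
  have h1 := mul_neg_geom_sum q m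
  have h2 : 0 ≤ ∑ i ∈ Finset.range m, q ^ i := Finset.sum_nonneg fun i _ => by positivity
  have h3 : 0 ≤ q ^ m := by positivity
  have h4 : ∑ i ∈ Finset.range m, q ^ i ≤ 2 := by nlinarith
  simp_rw [pow_succ', ← Finset.mul_sum]
  nlinarith

/-- With high probability no small vertex set spans many edges of `G_t`. -/
lemma uprob_exists_dense_le {t M : ℕ} (ht : t ≤ Fintype.card (CEdge n))
    (hq : 3 * n * (M : ℝ) ^ 2 * ((t : ℝ) / Fintype.card (CEdge n)) ^ 3 ≤ 1 / 2) :
    uprob (fun ω : EdgeOrdering n => ∃ U : Finset (Fin n), U.Nonempty ∧ U.card ≤ M ∧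
        3 * U.card ≤ (insideEdges U ∩ processEdges t ω).card) ≤
      2 * (3 * n * (M : ℝ) ^ 2 * ((t : ℝ) / Fintype.card (CEdge n)) ^ 3) := by
  set p : ℝ := (t : ℝ) / Fintype.card (CEdge n) with hp
  have hp0 : 0 ≤ p := by positivity
  have hU : ∀ i ∈ Finset.range M, ∀ U ∈ (Finset.univ : Finset (Fin n)).powersetCard (i + 1),
      uprob (fun ω : EdgeOrdering n => 3 * (i + 1) ≤ (insideEdges U ∩ processEdges t ω).card) ≤
        (((i + 1 : ℕ) : ℝ) * p) ^ (3 * (i + 1)) := by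
    intro i _ U hU
    have hc := (Finset.mem_powersetCard.1 hU).2
    refine (uprob_le_card_filter_le ht _ (card_insideEdges_le U) (by omega)).trans (le_of_eq ?_)
    rw [hc]
    congr 2
    push_cast
    field_simp
  calc _ ≤ uprob (fun ω : EdgeOrdering n => ∃ i ∈ Finset.range M,
          ∃ U ∈ (Finset.univ : Finset (Fin n)).powersetCard (i + 1),
            3 * (i + 1) ≤ (insideEdges U ∩ processEdges t ω).card) := by
        refine uprob_mono fun ω ⟨U, hne, hUM, h⟩ => ?_
        have h1 : U.card - 1 + 1 = U.card := Nat.sub_add_cancel (Finset.card_pos.2 hne)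
        refine ⟨U.card - 1, Finset.mem_range.2 (by omega), U, ?_, ?_⟩
        · rw [Finset.mem_powersetCard, h1]
          exact ⟨Finset.subset_univ _, rfl⟩
        · rwa [h1]
    _ ≤ ∑ i ∈ Finset.range M, ∑ U ∈ (Finset.univ : Finset (Fin n)).powersetCard (i + 1),
          uprob (fun ω : EdgeOrdering n =>
            3 * (i + 1) ≤ (insideEdges U ∩ processEdges t ω).card) :=
        (uprob_exists_le _ _).trans (Finset.sum_le_sum fun i _ => uprob_exists_le _ _)
    _ ≤ ∑ i ∈ Finset.range M, ∑ U ∈ (Finset.univ : Finset (Fin n)).powersetCard (i + 1),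
          (((i + 1 : ℕ) : ℝ) * p) ^ (3 * (i + 1)) :=
        Finset.sum_le_sum fun i hi => Finset.sum_le_sum (hU i hi)
    _ = ∑ i ∈ Finset.range M,
          (n.choose (i + 1) : ℝ) * (((i + 1 : ℕ) : ℝ) * p) ^ (3 * (i + 1)) := by
        simp
    _ ≤ ∑ i ∈ Finset.range M, (3 * n * (M : ℝ) ^ 2 * p ^ 3) ^ (i + 1) := by
        refine Finset.sum_le_sum fun i hi => ?_
        have hiM : ((i + 1 : ℕ) : ℝ) ≤ M := by
          exact_mod_cast Nat.succ_le_of_lt (Finset.mem_range.1 hi)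
        calc _ ≤ (3 * n / ((i + 1 : ℕ) : ℝ)) ^ (i + 1) *
                (((i + 1 : ℕ) : ℝ) * p) ^ (3 * (i + 1)) := by
              gcongr
              exact choose_le_div_pow n (Nat.succ_pos i)
          _ = (3 * n * ((i + 1 : ℕ) : ℝ) ^ 2 * p ^ 3) ^ (i + 1) := by
              rw [pow_mul, ← mul_pow]
              congr 1
              field_simp
          _ ≤ _ := by gcongr
    _ ≤ _ := sum_pow_succ_le (by positivity) hq M

end UnionBounds

section Cycles

variable {n : ℕ}

lemma not_containsCopy_empty {L : ℕ} (hL : 2 ≤ L) :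
    ¬ containsCopy (SimpleGraph.cycleGraph (L + 1)) n ∅ := by
  obtain ⟨m, rfl⟩ : ∃ m, L = m + 1 := ⟨L - 1, by omega⟩
  rintro ⟨f, _, h⟩
  obtain ⟨e, he, _⟩ := h 0 1 (by simp [SimpleGraph.cycleGraph_adj])
  simp at he

/-- The purchase completing the first copy of a cycle. -/
lemma exists_mem_closingEdges_build (b : ℕ) (S : Strategy n) (ω : EdgeOrdering n) {L t : ℕ}
    (hL : 2 ≤ L)
    (h : containsCopy (SimpleGraph.cycleGraph (L + 1)) n (build n b S ω t)) :
    ∃ s < t, ∃ hs : s < Fintype.card (CEdge n), ω ⟨s, hs⟩ ∈ closingEdges (build n b S ω s) L := by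
  induction t with
  | zero => exact absurd h (not_containsCopy_empty hL)
  | succ t ih =>
    by_cases ht : containsCopy (SimpleGraph.cycleGraph (L + 1)) n (build n b S ω t)
    · obtain ⟨s, hst, h⟩ := ih ht
      exact ⟨s, by omega, h⟩
    · simp only [build] at h
      split_ifs at h with h1 h2
      · exact ⟨t, by omega, h1, exists_walk_of_containsCopy_insert hL _ _ h ht⟩
      · exact absurd h ht
      · exact absurd h ht

lemma uprob_containsCopy_cycle_le (S : Strategy n) {t b k L D : ℕ}
    (ht : t < Fintype.card (CEdge n)) (hL : 2 ≤ L) (hLk : L ≤ 2 * k + 1) (hD : 0 < D)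
    (hq : 3 * n * ((2 * b : ℕ) : ℝ) ^ 2 * ((t : ℝ) / Fintype.card (CEdge n)) ^ 3 ≤ 1 / 2) :
    uprob (fun ω : EdgeOrdering n =>
        containsCopy (SimpleGraph.cycleGraph (L + 1)) n (build n b S ω t)) ≤
      n * (3 * n / D * ((t : ℝ) / Fintype.card (CEdge n))) ^ D +
      2 * (3 * n * ((2 * b : ℕ) : ℝ) ^ 2 * ((t : ℝ) / Fintype.card (CEdge n)) ^ 3) +
      t * ((2 * b * (7 ^ L * D ^ k) : ℕ) / ((Fintype.card (CEdge n) : ℝ) - t)) := by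
  set M := 2 * b * (7 ^ L * D ^ k) with hM
  set X : ℕ → EdgeOrdering n → Finset (CEdge n) := fun s ω =>
    if (closingEdges (build n b S ω s) L).card ≤ M then closingEdges (build n b S ω s) L else ∅
    with hX
  have hXcard : ∀ s ω, (X s ω).card ≤ M := by
    intro s ω
    simp only [hX]
    split_ifs with h
    · exact h
    · simp
  have hXprob : ∀ s ∈ Finset.range t,
      uprob (fun ω : EdgeOrdering n => ∃ hs : s < Fintype.card (CEdge n), ω ⟨s, hs⟩ ∈ X s ω) ≤
        M / ((Fintype.card (CEdge n) : ℝ) - t) := by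
    intro s hs
    have hst := Finset.mem_range.1 hs
    refine (uprob_mono fun ω ⟨_, h⟩ => h).trans ((uprob_apply_mem_le (hst.trans ht) M (X s)
      (fun ω ω' h => ?_) (hXcard s)).trans ?_)
    · simp only [hX, build_congr b S h]
    · have h1 : (t : ℝ) < Fintype.card (CEdge n) := by exact_mod_cast ht
      have h2 : (s : ℝ) ≤ t := by exact_mod_cast hst.le
      gcongr
  calc _ ≤ uprob (fun ω : EdgeOrdering n =>
          ((∃ v, D ≤ (starEdges v ∩ processEdges t ω).card) ∨
          (∃ U : Finset (Fin n), U.Nonempty ∧ U.card ≤ 2 * b ∧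
            3 * U.card ≤ (insideEdges U ∩ processEdges t ω).card)) ∨
          ∃ s ∈ Finset.range t, ∃ hs : s < Fintype.card (CEdge n), ω ⟨s, hs⟩ ∈ X s ω) := by
        refine uprob_mono fun ω h => ?_
        by_contra hcon
        rw [not_or, not_or] at hcon
        obtain ⟨⟨h1, h2⟩, h3⟩ := hcon
        push Not at h1 h2
        obtain ⟨s, hst, hs, hmem⟩ := exists_mem_closingEdges_build b S ω hL h
        have hsub : build n b S ω s ⊆ processEdges t ω :=
          (build_subset_processEdges b S ω s).trans (processEdges_mono hst.le ω)
        have hcard : (closingEdges (build n b S ω s) L).card ≤ M := by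
          refine card_closingEdges_le _ (card_build_le b S ω s) hD (fun v => ?_)
            (fun U hU hUb => ?_) (by omega) hLk
          · refine le_trans (Finset.card_le_card fun e he => ?_) (h1 v).le
            have he := (@Finset.mem_filter _ _ _ _ _).1 he
            exact Finset.mem_inter.2
              ⟨(@Finset.mem_filter _ _ _ _ _).2 ⟨Finset.mem_univ _, he.2⟩, hsub he.1⟩
          · refine lt_of_le_of_lt (Finset.card_le_card fun e he => ?_) (h2 U hU hUb)
            have he := (@Finset.mem_filter _ _ _ _ _).1 he
            exact Finset.mem_inter.2
              ⟨(@Finset.mem_filter _ _ _ _ _).2 ⟨Finset.mem_univ _, he.2⟩, hsub he.1⟩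
        exact h3 ⟨s, Finset.mem_range.2 hst, hs, by simpa only [hX, if_pos hcard] using hmem⟩
    _ ≤ _ := by
        refine (uprob_or_le _ _).trans (add_le_add ((uprob_or_le _ _).trans
          (add_le_add (uprob_exists_degree_le ht.le hD) (uprob_exists_dense_le ht.le hq))) ?_)
        refine (uprob_exists_le _ _).trans ((Finset.sum_le_sum hXprob).trans ?_)
        simp

end Cycles

section Asymptotics

lemma uprob_containsCopy_cycle_le_of_small {n t b k L : ℕ} (S : Strategy n) (hk : 1 ≤ k)
    (hL : 2 ≤ L) (hLk : L ≤ 2 * k + 1) (hn : 3 ≤ n) (hb : 1 ≤ b) (hnt : n ≤ t)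
    (hlog : (n : ℝ) * Real.log n ≤ t)
    (hε : (b : ℝ) * (t : ℝ) ^ (k + 1) / (n : ℝ) ^ (k + 2) ≤ 1 / 1000) :
    uprob (fun ω : EdgeOrdering n =>
        containsCopy (SimpleGraph.cycleGraph (L + 1)) n (build n b S ω t)) ≤
      1 / n + (648 + 8 * 7 ^ L * 28 ^ k) *
        ((b : ℝ) * (t : ℝ) ^ (k + 1) / (n : ℝ) ^ (k + 2)) := by
  have hn' : (3 : ℝ) ≤ n := by exact_mod_cast hn
  have hn0 : (0 : ℝ) < n := by linarith
  have hb' : (1 : ℝ) ≤ b := by exact_mod_cast hb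
  set x : ℝ := (t : ℝ) / n with hx
  have htx : (t : ℝ) = x * n := by rw [hx]; field_simp
  have hx1 : 1 ≤ x := by
    rw [hx, le_div_iff₀ hn0, one_mul]; exact_mod_cast hnt
  have hxlog : Real.log n ≤ x := by
    rw [hx, le_div_iff₀ hn0, mul_comm]; exact hlog
  have hε_eq : (b : ℝ) * (t : ℝ) ^ (k + 1) / (n : ℝ) ^ (k + 2) = b * x ^ (k + 1) / n := by
    rw [htx, mul_pow, pow_succ (n : ℝ) (k + 1)]; field_simp
  rw [hε_eq] at hε ⊢
  set ε : ℝ := b * x ^ (k + 1) / n with hε_def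
  have hη : b * x ^ 2 / n ≤ ε := by
    rw [hε_def]
    gcongr
    omega
  have hη0 : 0 ≤ b * x ^ 2 / n := by positivity
  have hxn : x / n ≤ b * x ^ 2 / n := by
    gcongr
    nlinarith [sq_nonneg x]
  have hN : (n : ℝ) ^ 2 / 3 ≤ Fintype.card (CEdge n) := by
    rw [Sym2.card_subtype_not_diag, Fintype.card_fin, Nat.cast_choose_two]
    nlinarith
  have ht_small : (t : ℝ) ≤ n ^ 2 / 1000 := by
    have h1 : x / n ≤ 1 / 1000 := hxn.trans (hη.trans hε)
    rw [div_le_iff₀ hn0] at h1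
    rw [htx]
    nlinarith
  have hn2 : (0 : ℝ) < (n : ℝ) ^ 2 := by positivity
  have htN : t < Fintype.card (CEdge n) := by
    have : (t : ℝ) < Fintype.card (CEdge n) := by linarith
    exact_mod_cast this
  have hp : (t : ℝ) / Fintype.card (CEdge n) ≤ 3 * x / n := by
    calc (t : ℝ) / Fintype.card (CEdge n) ≤ t / ((n : ℝ) ^ 2 / 3) := by gcongr
      _ = 3 * x / n := by rw [htx]; field_simp
  have hq : 3 * n * ((2 * b : ℕ) : ℝ) ^ 2 * ((t : ℝ) / Fintype.card (CEdge n)) ^ 3 ≤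
      324 * ε := by
    calc 3 * n * ((2 * b : ℕ) : ℝ) ^ 2 * ((t : ℝ) / Fintype.card (CEdge n)) ^ 3
        ≤ 3 * n * ((2 * b : ℕ) : ℝ) ^ 2 * (3 * x / n) ^ 3 := by gcongr
      _ = 324 * ((b * x ^ 2 / n) ^ 2 * (1 / x)) := by push_cast; field_simp; norm_num
      _ ≤ 324 * ((b * x ^ 2 / n) ^ 2 * 1) := by
          gcongr
          rw [div_le_one (by linarith)]; exact hx1
      _ ≤ 324 * ε := by
          have : (b * x ^ 2 / n) ^ 2 ≤ b * x ^ 2 / n := by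
            rw [sq]; exact mul_le_of_le_one_left hη0 (by linarith)
          linarith
  set D : ℕ := ⌈27 * x⌉₊ with hD
  have hD1 : 27 * x ≤ D := Nat.le_ceil _
  have hD2 : (D : ℝ) ≤ 28 * x := by
    have := Nat.ceil_lt_add_one (show 0 ≤ 27 * x by linarith)
    linarith
  have hD0 : (0 : ℝ) < D := by linarith
  have hdeg : n * (3 * n / D * ((t : ℝ) / Fintype.card (CEdge n))) ^ D ≤ (1 : ℝ) / n := by
    have hbase : 3 * n / D * ((t : ℝ) / Fintype.card (CEdge n)) ≤ Real.exp (-1) := by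
      calc 3 * n / D * ((t : ℝ) / Fintype.card (CEdge n)) ≤ 3 * n / D * (3 * x / n) := by gcongr
        _ = 9 * x / D := by field_simp; norm_num
        _ ≤ 1 / 3 := by rw [div_le_iff₀ hD0]; linarith
        _ ≤ Real.exp (-1) := by
          rw [Real.exp_neg, ← one_div]
          exact one_div_le_one_div_of_le (Real.exp_pos _) Real.exp_one_lt_three.le
    calc n * (3 * n / D * ((t : ℝ) / Fintype.card (CEdge n))) ^ D
        ≤ n * Real.exp (-1) ^ D := by gcongr
      _ = n * Real.exp (-D) := by rw [← Real.exp_nat_mul]; congr 2; ring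
      _ ≤ n * Real.exp (-(2 * Real.log n)) := by
          gcongr
          linarith
      _ = 1 / n := by
          rw [Real.exp_neg, two_mul, Real.exp_add, Real.exp_log hn0]
          field_simp
  have hclose : t * (((2 * b * (7 ^ L * D ^ k) : ℕ) : ℝ) / ((Fintype.card (CEdge n) : ℝ) - t)) ≤
      8 * 7 ^ L * 28 ^ k * ε := by
    have h4 : (n : ℝ) ^ 2 / 4 ≤ (Fintype.card (CEdge n) : ℝ) - t := by linarith
    push_cast
    calc t * ((2 * b * (7 ^ L * (D : ℝ) ^ k)) / ((Fintype.card (CEdge n) : ℝ) - t))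
        ≤ t * ((2 * b * (7 ^ L * (28 * x) ^ k)) / ((n : ℝ) ^ 2 / 4)) := by gcongr
      _ = 8 * 7 ^ L * 28 ^ k * ε := by
          rw [htx, hε_def, mul_pow]; field_simp; ring
  refine (uprob_containsCopy_cycle_le S htN hL hLk (by exact_mod_cast hD0)
    (by linarith)).trans ?_
  linarith

end Asymptotics

/-- Cycles, specific lower bound: let `H = C_ℓ` with `ℓ = 2k+1` or `ℓ = 2k+2`.  If
`t ≫ n log n` and `b ≪ n^{k+2}/t^{k+1}` (i.e. `b t^{k+1}/n^{k+2} → 0`), then every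
`(t,b)`-strategy fails, with high probability, to build a copy of `H`. -/
theorem stmt9 (k : ℕ) (hk : 1 ≤ k) (ℓ : ℕ) (hℓ : ℓ = 2 * k + 1 ∨ ℓ = 2 * k + 2)
    (t b : ℕ → ℕ)
    (ht : Tendsto (fun n : ℕ => (t n : ℝ) / ((n : ℝ) * Real.log n)) atTop atTop)
    (hb : Tendsto
      (fun n : ℕ => (b n : ℝ) * (t n : ℝ) ^ (k + 1) / (n : ℝ) ^ (k + 2)) atTop (nhds 0)) :
    ∀ S : (n : ℕ) → Strategy n,
      Tendsto
        (fun n => uprob (fun ω : EdgeOrdering n =>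
          containsCopy (SimpleGraph.cycleGraph ℓ) n (build n (b n) (S n) ω (t n))))
        atTop (nhds 0) := by
  intro S
  obtain ⟨L, rfl, hL2, hLk⟩ : ∃ L, ℓ = L + 1 ∧ 2 ≤ L ∧ L ≤ 2 * k + 1 :=
    ⟨ℓ - 1, by omega, by omega, by omega⟩
  have hlim : Tendsto (fun n : ℕ => 1 / (n : ℝ) + (648 + 8 * 7 ^ L * 28 ^ k) *
      ((b n : ℝ) * (t n : ℝ) ^ (k + 1) / (n : ℝ) ^ (k + 2))) atTop (nhds 0) := by
    simpa using tendsto_one_div_atTop_nhds_zero_nat.add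
      (hb.const_mul ((648 : ℝ) + 8 * 7 ^ L * 28 ^ k))
  refine tendsto_of_tendsto_of_tendsto_of_le_of_le' tendsto_const_nhds hlim
    (Eventually.of_forall fun n => uprob_nonneg _) ?_
  filter_upwards [ht.eventually_ge_atTop 1,
    hb.eventually_le_const (by norm_num : (0 : ℝ) < 1 / 1000), eventually_ge_atTop 3] with n htn hbn hn
  rcases Nat.eq_zero_or_pos (b n) with hb0 | hb0
  · have h0 : uprob (fun ω : EdgeOrdering n => containsCopy (SimpleGraph.cycleGraph (L + 1)) n
        (build n (b n) (S n) ω (t n))) ≤ uprob (fun _ : EdgeOrdering n => False) := by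
      refine uprob_mono fun ω h => ?_
      have hc := card_build_le (b n) (S n) ω (t n)
      rw [hb0, Nat.le_zero, Finset.card_eq_zero] at hc
      rw [hb0, hc] at h
      exact not_containsCopy_empty hL2 h
    refine h0.trans ?_
    have : uprob (fun _ : EdgeOrdering n => False) = 0 := by simp [uprob]
    rw [this]
    positivity
  · have hn' : (3 : ℝ) ≤ n := by exact_mod_cast hn
    have hlog : 1 ≤ Real.log n := by
      rw [Real.le_log_iff_exp_le (by linarith)]
      exact Real.exp_one_lt_three.le.trans hn'
    have hnlog : (n : ℝ) * Real.log n ≤ t n := by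
      rwa [le_div_iff₀ (by positivity), one_mul] at htn
    have hnt : (n : ℝ) ≤ t n := by nlinarith
    exact uprob_containsCopy_cycle_le_of_small (S n) hk hL2 hLk hn hb0 (by exact_mod_cast hnt)
      hnlog hbn
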